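/- For every strategic game H (with arbitrary strategy sets), taking beliefs to be joint strategies of the opponents: G_{CK(br^g)} = G_{CB(br^g)} ⊆ T_{sd^l}^∞. That is, common knowledge (equivalently, truth and common belief) of br^g-rationality implies that players choose only strategies that survive the possibly transfinite iterated elimination of strategies strictly dominated within the current restriction. -/

import Mathlib

universe u

/-- The α-th transfinite iterate of an operator `T` on a complete lattice,
starting at the largest element `⊤`: `T^0 = ⊤`, `T^(α+1) = T (T^α)`,
and `T^β = ⋂_{α<β} T^α` for limit ordinals `β`. -/
noncomputable def iterOp {D : Type u} [CompleteLattice D] (T : D → D) (α : Ordinal.{u}) : D :=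
  Ordinal.limitRecOn α ⊤ (fun _ x => T x)
    (fun β _ IH => ⨅ γ : {γ : Ordinal // γ < β}, IH γ.1 γ.2)

/-- The closure ordinal of `T`: the least `α` with `T^(α+1) = T^α`. -/
noncomputable def closureOrd {D : Type u} [CompleteLattice D] (T : D → D) : Ordinal.{u} :=
  sInf {α : Ordinal | iterOp T (α + 1) = iterOp T α}

/-- The outcome `T^∞` of iterating `T`: the iterate at the closure ordinal. -/
noncomputable def outcomeOp {D : Type u} [CompleteLattice D] (T : D → D) : D :=
  iterOp T (closureOrd T)

/-- `s'` strictly dominates `s` on the restriction `G` for player `i`: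
`p_i(s', t_{-i}) > p_i(s, t_{-i})` for every joint strategy `t_{-i}` of the
opponents taken from `G`. -/
def StrDom {ι : Type*} [DecidableEq ι] {T : ι → Type*} (p : ∀ i : ι, (∀ j, T j) → ℝ)
    (i : ι) (G : ∀ j, Set (T j)) (s' s : T i) : Prop :=
  ∀ t : ∀ j, T j, (∀ j, j ≠ i → t j ∈ G j) →
    p i (Function.update t i s') > p i (Function.update t i s)

/-- `sd^l(s, G)`: `s` is not strictly dominated on `G` by any strategy from `G i`. -/
def sdL {ι : Type*} [DecidableEq ι] {T : ι → Type*} (p : ∀ i : ι, (∀ j, T j) → ℝ)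
    (i : ι) (s : T i) (G : ∀ j, Set (T j)) : Prop :=
  ¬ ∃ s' ∈ G i, StrDom p i G s' s

/-- `br^g(s, G)` (beliefs = joint strategies of the opponents): `s` is a best
response among all strategies in `T i` to some joint strategy of the opponents
taken from `G`. -/
def brG {ι : Type*} [DecidableEq ι] {T : ι → Type*} (p : ∀ i : ι, (∀ j, T j) → ℝ)
    (i : ι) (s : T i) (G : ∀ j, Set (T j)) : Prop :=
  ∃ t : ∀ j, T j, (∀ j, j ≠ i → t j ∈ G j) ∧
    ∀ s' : T i, p i (Function.update t i s) ≥ p i (Function.update t i s')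

/-- The operator `T_φ` on restrictions: it removes from each component `G i` the
strategies `s` for which `φ i s G` fails. -/
def TOp {ι : Type*} {T : ι → Type*} (φ : ∀ i : ι, T i → (∀ j, Set (T j)) → Prop)
    (G : ∀ j, Set (T j)) : ∀ j, Set (T j) :=
  fun i => {s ∈ G i | φ i s G}

/-- A belief correspondence: nonempty values, and `ω' ∈ P(ω)` implies `P(ω') = P(ω)`. -/
def BeliefCorr {Ω : Type*} (P : Ω → Set Ω) : Prop :=
  (∀ ω, (P ω).Nonempty) ∧ ∀ ω ω', ω' ∈ P ω → P ω' = P ω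

/-- A knowledge correspondence: a belief correspondence with `ω ∈ P(ω)`. -/
def KnowledgeCorr {Ω : Type*} (P : Ω → Set Ω) : Prop :=
  BeliefCorr P ∧ ∀ ω, ω ∈ P ω

/-- An event `F` is evident if `P_i(ω) ⊆ F` for all `ω ∈ F` and all players `i`. -/
def EvidentEvent {ι Ω : Type*} (P : ι → Ω → Set Ω) (F : Set Ω) : Prop :=
  ∀ ω ∈ F, ∀ i, P i ω ⊆ F

/-- `E` is common knowledge at `ω`: some evident `F` satisfies `ω ∈ F ⊆ E`. -/
def CommonKnowledgeAt {ι Ω : Type*} (P : ι → Ω → Set Ω) (E : Set Ω) (ω : Ω) : Prop :=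
  ∃ F : Set Ω, EvidentEvent P F ∧ ω ∈ F ∧ F ⊆ E

/-- The belief operator `B E = {ω | ∀ i, P_i(ω) ⊆ E}`. -/
def beliefOp {ι Ω : Type*} (P : ι → Ω → Set Ω) (E : Set Ω) : Set Ω :=
  {ω | ∀ i, P i ω ⊆ E}

/-- `E` is common belief at `ω`: some evident `F` satisfies `ω ∈ F ⊆ B E`. -/
def CommonBeliefAt {ι Ω : Type*} (P : ι → Ω → Set Ω) (E : Set Ω) (ω : Ω) : Prop :=
  ∃ F : Set Ω, EvidentEvent P F ∧ ω ∈ F ∧ F ⊆ beliefOp P E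

/-- The restriction `G_E` determined by an event `E`: its `i`-th component is
`{s_i(ω') | ω' ∈ E}`. -/
def restrOf {ι Ω : Type*} {T : ι → Type*} (σ : ∀ i : ι, Ω → T i) (E : Set Ω) :
    ∀ i, Set (T i) :=
  fun i => σ i '' E

/-- `RAT(φ̄)`: the set of states at which each player `i` is `φ_i`-rational, i.e.
`φ_i(s_i(ω), G_{P_i(ω)})` holds. -/
def RATset {ι Ω : Type*} {T : ι → Type*} (φ : ∀ i : ι, T i → (∀ j, Set (T j)) → Prop)
    (σ : ∀ i : ι, Ω → T i) (P : ι → Ω → Set Ω) : Set Ω :=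
  {ω | ∀ i, φ i (σ i ω) (restrOf σ (P i ω))}

/-- `CK(φ̄)`: states at which, for some knowledge correspondences, `RAT(φ̄)` is
common knowledge. -/
def CKset {ι Ω : Type*} {T : ι → Type*} (φ : ∀ i : ι, T i → (∀ j, Set (T j)) → Prop)
    (σ : ∀ i : ι, Ω → T i) : Set Ω :=
  {ω | ∃ P : ι → Ω → Set Ω, (∀ i, KnowledgeCorr (P i)) ∧
        CommonKnowledgeAt P (RATset φ σ P) ω}

/-- `CB(φ̄)`: states `ω` at which, for some belief correspondences, `ω ∈ RAT(φ̄)`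
and `RAT(φ̄)` is common belief at `ω`. -/
def CBset {ι Ω : Type*} {T : ι → Type*} (φ : ∀ i : ι, T i → (∀ j, Set (T j)) → Prop)
    (σ : ∀ i : ι, Ω → T i) : Set Ω :=
  {ω | ∃ P : ι → Ω → Set Ω, (∀ i, BeliefCorr (P i)) ∧
        ω ∈ RATset φ σ P ∧ CommonBeliefAt P (RATset φ σ P) ω}

/-- If `T` preserves the property of lying above `G`, then every iterate of `T` lies above `G`. -/
theorem le_iterOp {D : Type u} [CompleteLattice D] {T : D → D} {G : D}
    (h : ∀ x, G ≤ x → G ≤ T x) (α : Ordinal.{u}) : G ≤ iterOp T α := by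
  induction α using Ordinal.limitRecOn with
  | zero => simp [iterOp]
  | add_one α ih =>
    rw [iterOp, Ordinal.limitRecOn_add_one]
    exact h _ ih
  | limit α hα ih =>
    rw [iterOp, Ordinal.limitRecOn_limit _ _ _ _ hα]
    exact le_iInf fun γ => ih γ.1 γ.2

section Game

variable {ι Ω : Type*} {T : ι → Type*}

theorem restrOf_mono (σ : ∀ i : ι, Ω → T i) : Monotone (restrOf σ) :=
  fun _ _ h _ => Set.image_mono h

theorem CKset_subset_CBset (φ : ∀ i : ι, T i → (∀ j, Set (T j)) → Prop) (σ : ∀ i : ι, Ω → T i) :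
    CKset φ σ ⊆ CBset φ σ := by
  rintro ω ⟨P, hP, F, hev, hω, hF⟩
  exact ⟨P, fun i => (hP i).1, hF hω, F, hev, hω, fun ω' hω' i => (hev ω' hω' i).trans hF⟩

variable [DecidableEq ι] {p : ∀ i : ι, (∀ j, T j) → ℝ}

theorem brG.mono {i : ι} {s : T i} {G G' : ∀ j, Set (T j)} (h : brG p i s G) (hG : G ≤ G') :
    brG p i s G' := by
  obtain ⟨t, ht, hbest⟩ := h
  exact ⟨t, fun j hj => hG j (ht j hj), hbest⟩

theorem brG.sdL {i : ι} {s : T i} {G : ∀ j, Set (T j)} (h : brG p i s G) : sdL p i s G := by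
  obtain ⟨t, ht, hbest⟩ := h
  rintro ⟨s', -, hdom⟩
  exact (hbest s').not_gt (hdom t ht)

/-- A restriction all of whose strategies are best responses to it survives the iterated
elimination of strategies strictly dominated within the current restriction. -/
theorem le_outcomeOp_sdL_of_brG {G : ∀ j, Set (T j)} (hG : ∀ i, ∀ s ∈ G i, brG p i s G) :
    G ≤ outcomeOp (TOp (sdL p)) :=
  le_iterOp (fun _ hx i s hs => ⟨hx i hs, ((hG i s hs).mono hx).sdL⟩) _

theorem restrOf_CKset_brG_le (σ : ∀ i : ι, Ω → T i) :
    restrOf σ (CKset (brG p) σ) ≤ outcomeOp (TOp (sdL p)) := by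
  rintro i _ ⟨ω, ⟨P, -, F, hev, hω, hF⟩, rfl⟩
  refine le_outcomeOp_sdL_of_brG (G := restrOf σ F) ?_ i (Set.mem_image_of_mem _ hω)
  rintro j _ ⟨ω', hω', rfl⟩
  exact (hF hω' j).mono (restrOf_mono σ (hev ω' hω' j))

/-- The correspondence of the two-cell partition into `F` and its complement. -/
def cellCorr (F : Set Ω) (ω : Ω) : Set Ω := {ω' | ω' ∈ F ↔ ω ∈ F}

theorem knowledgeCorr_cellCorr (F : Set Ω) : KnowledgeCorr (cellCorr F) := by
  refine ⟨⟨fun ω => ⟨ω, Iff.rfl⟩, fun ω ω' h => ?_⟩, fun ω => Iff.rfl⟩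
  ext ω''
  exact iff_congr Iff.rfl h

theorem cellCorr_of_mem {F : Set Ω} {ω : Ω} (h : ω ∈ F) : cellCorr F ω = F := by
  ext ω'
  simp [cellCorr, h]

theorem CBset_brG_subset_CKset (σ : ∀ i : ι, Ω → T i) : CBset (brG p) σ ⊆ CKset (brG p) σ := by
  rintro ω ⟨P, -, hrat, F, hev, hω, hF⟩
  set F' : Set Ω := F ∩ RATset (brG p) σ P
  refine ⟨fun _ => cellCorr F', fun _ => knowledgeCorr_cellCorr F', F',
    fun ω' hω' _ => (cellCorr_of_mem hω').subset, ⟨hω, hrat⟩, fun ω' hω' j => ?_⟩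
  beta_reduce
  rw [cellCorr_of_mem hω']
  exact (hω'.2 j).mono (restrOf_mono σ (Set.subset_inter (hev ω' hω'.1 j) (hF hω'.1 j)))

theorem CKset_brG_eq_CBset_brG (σ : ∀ i : ι, Ω → T i) : CKset (brG p) σ = CBset (brG p) σ :=
  (CKset_subset_CBset _ σ).antisymm (CBset_brG_subset_CKset σ)

end Game

/-- For arbitrary games, with beliefs being joint strategies of the opponents:
`G_{CK(br^g)} = G_{CB(br^g)} ⊆ T_{sd^l}^∞`. Common knowledge (equivalently, truth
and common belief) of `br^g`-rationality implies that players choose only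
strategies surviving the possibly transfinite iterated elimination of strategies
strictly dominated within the current restriction. -/
theorem GCK_brG_eq_GCB_brG_subset_TsdL {ι Ω : Type*} [Fintype ι] [Nontrivial ι]
    [DecidableEq ι] {T : ι → Type*} [∀ j, Nonempty (T j)]
    (p : ∀ i : ι, (∀ j, T j) → ℝ)
    (hcard : ∀ j, Nonempty (T j ↪ Ω)) (i : ι) :
    {s : T i | ∃ (σ : ∀ j : ι, Ω → T j) (ω : Ω), s = σ i ω ∧ ω ∈ CKset (brG p) σ} =
      {s : T i | ∃ (σ : ∀ j : ι, Ω → T j) (ω : Ω), s = σ i ω ∧ ω ∈ CBset (brG p) σ} ∧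
    {s : T i | ∃ (σ : ∀ j : ι, Ω → T j) (ω : Ω), s = σ i ω ∧ ω ∈ CKset (brG p) σ} ⊆
      outcomeOp (TOp (sdL p)) i := by
  refine ⟨by simp only [CKset_brG_eq_CBset_brG], ?_⟩
  rintro _ ⟨σ, ω, rfl, hω⟩
  exact restrOf_CKset_brG_le σ i (Set.mem_image_of_mem _ hω)
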